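/- Let 𝒳 be a separable real Hilbert space, (P_t)_{t≥0} a Markov transition semigroup on 𝒳, and Y a semi-dynamical system on 𝒳 (Y^x(0) = x, t ↦ Y^x(t) continuous, x ↦ Y^x(t) Borel measurable, Y^{Y^x(t)}(s) = Y^x(t+s)) with compact global attractor 𝒦 (𝒦 compact, invariant under Y, and for all ε, R > 0 there is T with Y^x(t) ∈ 𝒦 + εB(0,1) for all t ≥ T and ‖x‖ ≤ R). Assume the stochastic stability condition: for all ε, R, t > 0, inf_{‖x‖≤R} P_t(x, B(Y^x(t), ε)) > 0. Suppose B ⊆ 𝒳 is a bounded Borel set and r* > 0 are such that liminf_{T→∞} Q^T(x, B) > 1/2 for all x ∈ 𝒦 + r*B(0,1). Then for every bounded Borel set D ⊆ 𝒳 there exists γ > 0 such that liminf_{T→∞} Q^T(x, B) > γ for all x ∈ D. -/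

import Mathlib

open MeasureTheory Filter Topology Metric Set

noncomputable section

/-- A Markov transition semigroup on a measurable space `X`: a jointly measurable family
of Markov probability kernels `P t x` with `P 0 x = δ_x` and the Chapman–Kolmogorov
semigroup property for nonnegative times. -/
structure MarkovSemigroup (X : Type*) [MeasurableSpace X] where
  P : ℝ → X → MeasureTheory.Measure X
  prob : ∀ t x, MeasureTheory.IsProbabilityMeasure (P t x)
  meas : Measurable fun p : ℝ × X => P p.1 p.2
  init : ∀ x : X, P 0 x = MeasureTheory.Measure.dirac x
  semigroup : ∀ t s : ℝ, 0 ≤ t → 0 ≤ s → ∀ x : X,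
    P (t + s) x = (P t x).bind (P s)

namespace MarkovSemigroup

variable {X : Type*} [MeasurableSpace X]

/-- Action `P_t f(x) = ∫ f(y) P_t(x,dy)` on functions. -/
def act (M : MarkovSemigroup X) (t : ℝ) (f : X → ℝ) (x : X) : ℝ :=
  ∫ y, f y ∂(M.P t x)

/-- Dual action `P_t^* μ` on measures. -/
def dual (M : MarkovSemigroup X) (t : ℝ) (μ : MeasureTheory.Measure X) :
    MeasureTheory.Measure X :=
  μ.bind (M.P t)

/-- The time average `Q^T μ = (1/T) ∫_0^T P_s^* μ ds` (with the convention
`Q^T μ = μ` for `T ≤ 0`). -/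
def QM (M : MarkovSemigroup X) (T : ℝ) (μ : MeasureTheory.Measure X) :
    MeasureTheory.Measure X :=
  if T ≤ 0 then μ
  else ((ENNReal.ofReal (1 / T)) • (volume.restrict (Set.Ioc (0 : ℝ) T))).bind
    fun s => M.dual s μ

/-- `Q^T(x,·) := Q^T δ_x`. -/
def Q (M : MarkovSemigroup X) (T : ℝ) (x : X) : MeasureTheory.Measure X :=
  M.QM T (MeasureTheory.Measure.dirac x)

/-- Iterated averages: for `ts = [t_k, …, t_1]`, `QMs ts μ = Q^{t_k}(⋯(Q^{t_1} μ)⋯)`. -/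
def QMs (M : MarkovSemigroup X) (ts : List ℝ) (μ : MeasureTheory.Measure X) :
    MeasureTheory.Measure X :=
  ts.foldr (fun t ν => M.QM t ν) μ

/-- A measure is invariant if `P_t^* μ = μ` for all `t ≥ 0`. -/
def Invariant (M : MarkovSemigroup X) (μ : MeasureTheory.Measure X) : Prop :=
  ∀ t : ℝ, 0 ≤ t → M.dual t μ = μ

section TopologicalDefs

variable [TopologicalSpace X]

/-- Bounded continuous real functions. -/
def IsBddContinuous (f : X → ℝ) : Prop :=
  Continuous f ∧ ∃ C : ℝ, ∀ x, |f x| ≤ C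

/-- The Feller property: `P_t` maps bounded continuous functions to continuous ones. -/
def Feller (M : MarkovSemigroup X) : Prop :=
  ∀ t : ℝ, 0 ≤ t → ∀ f : X → ℝ, MarkovSemigroup.IsBddContinuous f →
    Continuous (M.act t f)

/-- Stochastic continuity: `P_t f(x) → f(x)` as `t → 0+`. -/
def StochasticallyContinuous (M : MarkovSemigroup X) : Prop :=
  ∀ f : X → ℝ, MarkovSemigroup.IsBddContinuous f → ∀ x : X,
    Filter.Tendsto (fun t : ℝ => M.act t f x) (nhdsWithin 0 (Set.Ioi 0)) (nhds (f x))

/-- Weak convergence of `Q^T ν` to `μ` as `T → ∞`. -/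
def QTendsto (M : MarkovSemigroup X) (ν μ : MeasureTheory.Measure X) : Prop :=
  ∀ f : X → ℝ, MarkovSemigroup.IsBddContinuous f →
    Filter.Tendsto (fun T : ℝ => ∫ x, f x ∂(M.QM T ν)) Filter.atTop
      (nhds (∫ x, f x ∂μ))

/-- Weak-* mean ergodicity with limit `μstar`. -/
def WeakStarMeanErgodic (M : MarkovSemigroup X) (μstar : MeasureTheory.Measure X) : Prop :=
  ∀ ν : MeasureTheory.Measure X, MeasureTheory.IsProbabilityMeasure ν → M.QTendsto ν μstar

/-- Tightness of the family `(Q^T(x,·))_{T>0}`. -/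
def TightAt (M : MarkovSemigroup X) (x : X) : Prop :=
  ∀ ε : ℝ, 0 < ε → ∃ K : Set X, IsCompact K ∧
    ∀ T : ℝ, 0 < T → 1 - ε ≤ ((M.Q T x) K).toReal

end TopologicalDefs

end MarkovSemigroup

/-- Topological support of a measure: points all of whose open neighborhoods
have positive mass. -/
def msupport {X : Type*} [MeasurableSpace X] [TopologicalSpace X]
    (μ : MeasureTheory.Measure X) : Set X :=
  {x : X | ∀ U : Set X, IsOpen U → x ∈ U → 0 < μ U}

/-- Total variation distance between two (finite) measures, as the supremum over
Borel sets of the discrepancy of masses. -/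
def tvDist {X : Type*} [MeasurableSpace X] (μ ν : MeasureTheory.Measure X) : ℝ :=
  ⨆ B : {B : Set X // MeasurableSet B}, |(μ B.1).toReal - (ν B.1).toReal|

section MetricDefs

variable {X : Type*} [MeasurableSpace X] [PseudoMetricSpace X]

/-- Bounded Lipschitz real functions. -/
def IsBddLipschitz (ψ : X → ℝ) : Prop :=
  (∃ K : NNReal, LipschitzWith K ψ) ∧ ∃ C : ℝ, ∀ x, |ψ x| ≤ C

/-- The e-property: equicontinuity of `(P_t ψ)_{t ≥ 0}` at every point, for every
bounded Lipschitz `ψ`. -/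
def MarkovSemigroup.EProperty (M : MarkovSemigroup X) : Prop :=
  ∀ ψ : X → ℝ, IsBddLipschitz ψ → ∀ x : X, ∀ ε : ℝ, 0 < ε →
    ∃ δ : ℝ, 0 < δ ∧ ∀ z : X, dist z x < δ → ∀ t : ℝ, 0 ≤ t →
      |M.act t ψ z - M.act t ψ x| < ε

end MetricDefs

namespace MarkovSemigroup

variable {X : Type*} [MeasurableSpace X]

lemma measurable_P_right (M : MarkovSemigroup X) (t : ℝ) : Measurable (M.P t) :=
  M.meas.comp measurable_prodMk_left

lemma measurable_P_left (M : MarkovSemigroup X) (x : X) : Measurable fun t => M.P t x :=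
  M.meas.comp measurable_prodMk_right

lemma dual_dirac (M : MarkovSemigroup X) (t : ℝ) (x : X) :
    M.dual t (Measure.dirac x) = M.P t x :=
  Measure.dirac_bind (M.measurable_P_right t) x

lemma Q_apply (M : MarkovSemigroup X) {T : ℝ} (hT : 0 < T) (x : X) {B : Set X}
    (hB : MeasurableSet B) :
    M.Q T x B = ENNReal.ofReal (1 / T) * ∫⁻ s in Ioc 0 T, M.P s x B := by
  simp only [Q, QM, if_neg (not_le.2 hT), dual_dirac]
  rw [Measure.bind_apply hB (M.measurable_P_left x).aemeasurable, lintegral_smul_measure,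
    smul_eq_mul]

lemma Q_le_one (M : MarkovSemigroup X) {T : ℝ} (hT : 0 < T) (x : X) {B : Set X}
    (hB : MeasurableSet B) : M.Q T x B ≤ 1 := by
  rw [M.Q_apply hT x hB]
  calc ENNReal.ofReal (1 / T) * ∫⁻ s in Ioc 0 T, M.P s x B
      ≤ ENNReal.ofReal (1 / T) * ∫⁻ _ in Ioc 0 T, 1 := by
        gcongr with s
        have := M.prob s x
        exact prob_le_one
    _ = 1 := by
        rw [setLIntegral_one, Real.volume_Ioc, sub_zero, ← ENNReal.ofReal_mul (by positivity),
          one_div_mul_cancel hT.ne', ENNReal.ofReal_one]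

lemma measurable_Q_apply (M : MarkovSemigroup X) {T : ℝ} (hT : 0 < T) {B : Set X}
    (hB : MeasurableSet B) : Measurable fun x => M.Q T x B := by
  simp only [M.Q_apply hT _ hB]
  exact (Measurable.lintegral_prod_left'
    (f := fun p : ℝ × X => M.P p.1 p.2 B) ((Measure.measurable_coe hB).comp M.meas)).const_mul _

/-- Running the chain for time `t` before averaging over `(0, T]` is dominated by averaging
over `(0, t + T]`, up to normalization. -/
lemma lintegral_Q_le (M : MarkovSemigroup X) {t T : ℝ} (ht : 0 ≤ t) (hT : 0 < T) (x : X)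
    {B : Set X} (hB : MeasurableSet B) :
    ENNReal.ofReal (T / (t + T)) * ∫⁻ y, M.Q T y B ∂(M.P t x) ≤ M.Q (t + T) x B := by
  have := M.prob t x
  have hmeas : Measurable fun p : X × ℝ => M.P p.2 p.1 B :=
    (Measure.measurable_coe hB).comp (M.meas.comp measurable_swap)
  have hswap : ∫⁻ y, (∫⁻ s in Ioc 0 T, M.P s y B) ∂(M.P t x)
      = ∫⁻ s in Ioc 0 T, M.P (t + s) x B := by
    rw [lintegral_lintegral_swap hmeas.aemeasurable]
    refine setLIntegral_congr_fun measurableSet_Ioc fun s hs => ?_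
    rw [M.semigroup t s ht hs.1.le, Measure.bind_apply hB (M.measurable_P_right s).aemeasurable]
  have hshift : ∫⁻ s in Ioc 0 T, M.P (t + s) x B = ∫⁻ s in Ioc t (t + T), M.P s x B := by
    have h := (measurePreserving_add_left (volume : Measure ℝ) t).setLIntegral_comp_preimage
      (s := Ioc t (t + T)) measurableSet_Ioc
      (f := fun s => M.P s x B) ((Measure.measurable_coe hB).comp (M.measurable_P_left x))
    simpa using h
  rw [M.Q_apply (by linarith) x hB]
  simp only [M.Q_apply hT _ hB]
  rw [lintegral_const_mul _ hmeas.lintegral_prod_right', ← mul_assoc,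
    ← ENNReal.ofReal_mul (by positivity), hswap, hshift,
    show T / (t + T) * (1 / T) = 1 / (t + T) by field_simp]
  gcongr

lemma isBoundedUnder_ge_Q (M : MarkovSemigroup X) (x : X) (B : Set X) :
    IsBoundedUnder (· ≥ ·) atTop fun T : ℝ => (M.Q T x B).toReal :=
  isBoundedUnder_of ⟨0, fun _ => ENNReal.toReal_nonneg⟩

lemma isBoundedUnder_le_Q (M : MarkovSemigroup X) (x : X) {B : Set X} (hB : MeasurableSet B) :
    IsBoundedUnder (· ≤ ·) atTop fun T : ℝ => (M.Q T x B).toReal :=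
  ⟨1, eventually_map.2 <| (eventually_gt_atTop 0).mono fun _ hT =>
    ENNReal.toReal_le_of_le_ofReal zero_le_one (by simpa using M.Q_le_one hT x hB)⟩

/-- If the averages started in `U` have lower limit above `a`, and `U` is reached from `x` at
time `t` with probability above `c`, then the averages started at `x` have lower limit at
least `a * c / 2`. -/
lemma le_liminf_Q (M : MarkovSemigroup X) {B U : Set X} (hB : MeasurableSet B) {a c t : ℝ}
    (ha : 0 ≤ a) (ht : 0 ≤ t)
    (hU : ∀ y ∈ U, a < liminf (fun T : ℝ => (M.Q T y B).toReal) atTop) {x : X}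
    (hx : ENNReal.ofReal c < M.P t x U) :
    a * c / 2 ≤ liminf (fun T : ℝ => (M.Q T x B).toReal) atTop := by
  let A : ℕ → Set X := fun n => {y | ∀ T : ℝ, n ≤ T → ENNReal.ofReal a ≤ M.Q T y B}
  have hA : Monotone A := fun m n hmn y hy T hT => hy T ((Nat.cast_le.2 hmn).trans hT)
  have hUA : U ⊆ ⋃ n, A n := fun y hy => by
    obtain ⟨T₀, hT₀⟩ := eventually_atTop.1
      (eventually_lt_of_lt_liminf (hU y hy) (M.isBoundedUnder_ge_Q y B))
    obtain ⟨n, hn⟩ := exists_nat_ge T₀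
    exact mem_iUnion.2 ⟨n, fun T hT => ENNReal.ofReal_le_of_le_toReal (hT₀ T (hn.trans hT)).le⟩
  obtain ⟨n, hn⟩ : ∃ n, ENNReal.ofReal c < M.P t x (A n) := by
    have h := hx.trans_le (measure_mono hUA)
    rwa [hA.measure_iUnion, lt_iSup_iff] at h
  refine le_liminf_of_le (M.isBoundedUnder_le_Q x hB).isCoboundedUnder_ge ?_
  filter_upwards [eventually_ge_atTop (2 * t + n + 1)] with S hS
  have hn0 : (0 : ℝ) ≤ n := n.cast_nonneg
  have hT : 0 < S - t := by linarith
  have hmarkov : ENNReal.ofReal a * ENNReal.ofReal c ≤ ∫⁻ y, M.Q (S - t) y B ∂(M.P t x) :=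
    calc ENNReal.ofReal a * ENNReal.ofReal c
        ≤ ENNReal.ofReal a * M.P t x {y | ENNReal.ofReal a ≤ M.Q (S - t) y B} := by
          gcongr
          exact hn.le.trans (measure_mono fun y hy => hy _ (by linarith))
      _ ≤ _ := mul_meas_ge_le_lintegral (M.measurable_Q_apply hT hB) _
  have hQ := M.lintegral_Q_le ht hT x hB
  rw [add_sub_cancel] at hQ
  have hhalf : 1 / 2 ≤ (S - t) / S := by
    rw [div_le_div_iff₀ two_pos (by linarith)]
    linarith
  refine (ENNReal.ofReal_le_iff_le_toReal
    ((M.Q_le_one (by linarith) x hB).trans_lt ENNReal.one_lt_top).ne).1 (le_trans ?_ hQ)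
  calc ENNReal.ofReal (a * c / 2)
      = ENNReal.ofReal (1 / 2) * (ENNReal.ofReal a * ENNReal.ofReal c) := by
        rw [← ENNReal.ofReal_mul ha, ← ENNReal.ofReal_mul (by norm_num)]
        congr 1
        ring
    _ ≤ _ := by gcongr

end MarkovSemigroup

/-- Step II of the proof of Theorem 3. On a separable Hilbert space,
given a semi-dynamical system `Y` with compact global attractor `𝒦`, stochastic
stability, and a bounded Borel set `B` with `liminf_T Q^T(x,B) > 1/2` on an
`r*`-neighborhood of `𝒦`, every bounded Borel set `D` admits `γ > 0` with
`liminf_T Q^T(x,B) > γ` for all `x ∈ D`. -/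
theorem ergodic_lower_bound_on_bounded_sets
    {X : Type*} [NormedAddCommGroup X] [InnerProductSpace ℝ X] [CompleteSpace X]
    [SecondCountableTopology X] [MeasurableSpace X] [BorelSpace X]
    (M : MarkovSemigroup X)
    -- the semi-dynamical system
    (Y : X → ℝ → X)
    (hY0 : ∀ x, Y x 0 = x)
    (hYcont : ∀ x, ContinuousOn (Y x) (Set.Ici (0 : ℝ)))
    (hYmeas : ∀ t : ℝ, 0 ≤ t → Measurable fun x => Y x t)
    (hYsemi : ∀ x : X, ∀ t : ℝ, 0 ≤ t → ∀ s : ℝ, 0 ≤ s → Y (Y x t) s = Y x (t + s))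
    -- compact global attractor
    (K : Set X) (hKcpt : IsCompact K)
    (hKinv : ∀ x ∈ K, ∀ t : ℝ, 0 ≤ t → Y x t ∈ K)
    (hKattr : ∀ ε : ℝ, 0 < ε → ∀ R : ℝ, 0 < R → ∃ T : ℝ,
      ∀ x : X, ‖x‖ ≤ R → ∀ t : ℝ, T ≤ t → Y x t ∈ Metric.thickening ε K)
    -- stochastic stability
    (hSS : ∀ ε : ℝ, 0 < ε → ∀ R : ℝ, 0 < R → ∀ t : ℝ, 0 < t →
      ∃ c : ℝ, 0 < c ∧ ∀ x : X, ‖x‖ ≤ R →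
        ENNReal.ofReal c ≤ (M.P t x) (Metric.ball (Y x t) ε))
    -- the set B
    (B : Set X) (hBbd : Bornology.IsBounded B) (hBmeas : MeasurableSet B)
    (rstar : ℝ) (hrstar : 0 < rstar)
    (hB : ∀ x ∈ Metric.thickening rstar K,
      (1 : ℝ) / 2 < Filter.liminf (fun T : ℝ => ((M.Q T x) B).toReal) Filter.atTop) :
    ∀ D : Set X, Bornology.IsBounded D → MeasurableSet D →
      ∃ γ : ℝ, 0 < γ ∧ ∀ x ∈ D,
        γ < Filter.liminf (fun T : ℝ => ((M.Q T x) B).toReal) Filter.atTop := by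
  intro D hD _
  obtain ⟨R, hR, hDR⟩ := hD.exists_pos_norm_le
  obtain ⟨T, hT⟩ := hKattr (rstar / 2) (half_pos hrstar) R hR
  have ht : 0 < max T 1 := lt_max_of_lt_right one_pos
  obtain ⟨c, hc, hcP⟩ := hSS (rstar / 2) (half_pos hrstar) R hR (max T 1) ht
  refine ⟨1 / 2 * (c / 2) / 4, by positivity, fun x hx => ?_⟩
  have hball : ball (Y x (max T 1)) (rstar / 2) ⊆ thickening rstar K := fun z hz => by
    obtain ⟨k, hk, hkd⟩ := mem_thickening_iff.1 (hT x (hDR x hx) _ (le_max_left T 1))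
    refine mem_thickening_iff.2 ⟨k, hk, ?_⟩
    linarith [dist_triangle z (Y x (max T 1)) k, mem_ball.1 hz]
  have hreach : ENNReal.ofReal (c / 2) < M.P (max T 1) x (thickening rstar K) :=
    ((ENNReal.ofReal_lt_ofReal_iff hc).2 (half_lt_self hc)).trans_le
      ((hcP x (hDR x hx)).trans (measure_mono hball))
  have hlim := M.le_liminf_Q hBmeas (by norm_num) ht.le hB hreach
  linarith
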